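/- For every d with 1 ≤ d ≤ n, the number of d-cycles in the graph G(n, 312) of overlapping 312-avoiding permutations equals (1/d)·Σ_{e | d} μ(d/e)·binomial(2e, e), where the sum is over all positive divisors e of d and μ is the number-theoretic Möbius function. -/

import Mathlib

/-- A permutation avoids the pattern 312 if there are no indices
`i < j < k` with `π j < π k < π i`. -/
def Avoids312 {m : ℕ} (π : Equiv.Perm (Fin m)) : Prop :=
  ¬ ∃ i j k : Fin m, i < j ∧ j < k ∧ π j < π k ∧ π k < π i

/-- An edge of the graph `G(n, 312)` of overlapping 312-avoiding permutations:
a 312-avoiding permutation `σ ∈ S_{n+1}`; its tail is `Π(σ_1 ⋯ σ_n)` and its head is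
`Π(σ_2 ⋯ σ_{n+1})` (standardizations of the first resp. last `n` letters). -/
def Edge (n : ℕ) : Type := {σ : Equiv.Perm (Fin (n + 1)) // Avoids312 σ}

/-- `head σ = tail τ` in `G(n, 312)`: the standardization of the last `n` letters of `σ`
equals the standardization of the first `n` letters of `τ`, i.e. the last `n` letters of
`σ` and the first `n` letters of `τ` are in the same relative order. -/
def HeadEqTail {n : ℕ} (σ τ : Edge n) : Prop :=
  ∀ a b : Fin n, (σ.1 a.succ < σ.1 b.succ ↔ τ.1 a.castSucc < τ.1 b.castSucc)

/-- A closed walk of length `d` in `G(n, 312)`: a cyclic list `(e_1, …, e_d)` of edges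
with `head (e_i) = tail (e_{i+1})` (indices mod `d`). -/
def ClosedWalk (n d : ℕ) : Type :=
  {w : ZMod d → Edge n // ∀ i : ZMod d, HeadEqTail (w i) (w (i + 1))}

/-- The equivalence class of a closed walk under cyclic shifts. -/
def walkClass {n d : ℕ} (w : ClosedWalk n d) : Set (ClosedWalk n d) :=
  {w' | ∃ c : ZMod d, ∀ i : ZMod d, w'.1 i = w.1 (i + c)}

/-- A `d`-cycle in `G(n, 312)` is an equivalence class, of size exactly `d`, of closed
walks of length `d` under cyclic shifts. -/
def IsCycleClass {n d : ℕ} (S : Set (ClosedWalk n d)) : Prop :=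
  (∃ w : ClosedWalk n d, S = walkClass w) ∧ S.ncard = d

section Part1

def Nx (R : ℤ → ℤ → Prop) (i j : ℤ) : Prop := R i j ∧ ∀ l, i < l → l < j → ¬ R i l

structure Good (n d : ℕ) (R : ℤ → ℤ → Prop) : Prop where
  lt : ∀ {i k : ℤ}, R i k → i < k
  le : ∀ {i k : ℤ}, R i k → k ≤ i + n
  per : ∀ i k, R (i + d) (k + d) ↔ R i k
  A : ∀ {i j k : ℤ}, i < j → j < k → k ≤ i + n → R i j → (R i k ↔ R j k)
  B : ∀ {i j k : ℤ}, i < j → j < k → k ≤ i + n → R i k → R i j ∨ R j k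

open Classical in
noncomputable def pre (n : ℕ) (R : ℤ → ℤ → Prop) (j : ℤ) : Finset ℤ :=
  (Finset.Ico (j - n) j).filter (fun i => Nx R i j)

variable {n d : ℕ} {R : ℤ → ℤ → Prop}

lemma mem_pre (h : Good n d R) {i j : ℤ} : i ∈ pre n R j ↔ Nx R i j := by
  classical
  unfold pre
  rw [Finset.mem_filter, Finset.mem_Ico]
  constructor
  · exact fun h => h.2
  · intro hx
    have h1 := h.lt hx.1
    have h2 := h.le hx.1
    exact ⟨⟨by omega, h1⟩, hx⟩

lemma Nx.unique (h : Good n d R) {i j k : ℤ} (h1 : Nx R i j) (h2 : Nx R i k) : j = k := by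
  have a1 := h.lt h1.1
  have a2 := h.lt h2.1
  rcases lt_trichotomy j k with hh | hh | hh
  · exact absurd h1.1 (h2.2 j a1 hh)
  · exact hh
  · exact absurd h2.1 (h1.2 k a2 hh)

lemma exists_nx (h : Good n d R) {i k : ℤ} (hR : R i k) : ∃ j, j ≤ k ∧ Nx R i j := by
  classical
  have hik := h.lt hR
  have hex : ∃ t : ℕ, R i (i + t) := ⟨(k - i).toNat, by
    rw [Int.toNat_of_nonneg (by omega)]; simpa using hR⟩
  refine ⟨i + Nat.find hex, ?_, Nat.find_spec hex, ?_⟩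
  · have : Nat.find hex ≤ (k - i).toNat := Nat.find_min' hex (by
      rw [Int.toNat_of_nonneg (by omega)]; simpa using hR)
    omega
  · intro l hl1 hl2 hl
    have : Nat.find hex ≤ (l - i).toNat := Nat.find_min' hex (by
      rw [Int.toNat_of_nonneg (by omega)]; simpa using hl)
    omega

lemma Nx.nest (h : Good n d R) {i j k : ℤ} (h1 : Nx R i k) (hij : i < j) (hjk : j < k) :
    ∃ k', k' ≤ k ∧ Nx R j k' := by
  have h2 := h.le h1.1
  rcases h.B hij hjk h2 h1.1 with h3 | h3
  · exact absurd h3 (h1.2 j hij hjk)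
  · exact exists_nx h h3

lemma per_mul (h : Good n d R) (i k c : ℤ) : R (i + c * d) (k + c * d) ↔ R i k := by
  induction c using Int.induction_on with
  | zero => simp
  | succ c ih =>
    rw [← ih, ← h.per (i + c * d) (k + c * d)]
    ring_nf
  | pred c ih =>
    rw [← ih, ← h.per (i + (-c - 1) * d) (k + (-c - 1) * d)]
    ring_nf

lemma nx_per_mul (h : Good n d R) (i k c : ℤ) : Nx R (i + c * d) (k + c * d) ↔ Nx R i k := by
  unfold Nx
  rw [per_mul h]
  refine and_congr_right fun _ => ⟨fun H l h1 h2 h3 => ?_, fun H l h1 h2 h3 => ?_⟩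
  · exact H (l + c * d) (by omega) (by omega) ((per_mul h _ _ _).2 h3)
  · refine H (l - c * d) (by omega) (by omega) ((per_mul h _ _ c).1 ?_)
    simpa using h3

noncomputable def cnt (n : ℕ) (R : ℤ → ℤ → Prop) (j : ℤ) : ℕ := (pre n R j).card

lemma cnt_per (h : Good n d R) (j : ℤ) : cnt n R (j + d) = cnt n R j := by
  unfold cnt
  symm
  refine Finset.card_bij (fun i _ => i + d) ?_ ?_ ?_
  · intro i hi
    rw [mem_pre h] at hi ⊢
    simpa using (nx_per_mul h i j 1).2 hi
  · intro a _ b _ hab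
    simpa using hab
  · intro b hb
    rw [mem_pre h] at hb
    refine ⟨b - d, ?_, by ring⟩
    rw [mem_pre h]
    have := nx_per_mul h (b - d) j 1
    simp only [one_mul, sub_add_cancel] at this
    exact this.1 hb

def IsPot (S : ℤ → ℤ) (a : ℤ → ℕ) : Prop := ∀ k, S (k + 1) = S k + a (k + 1) - 1

lemma exists_pot (a : ℤ → ℕ) : ∃ S, IsPot S a := by
  refine ⟨fun k => ∑ j ∈ Finset.range k.toNat, ((a (j + 1) : ℤ) - 1)
    - ∑ j ∈ Finset.range (-k).toNat, ((a (-j) : ℤ) - 1), ?_⟩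
  intro k
  rcases le_or_gt 0 k with hk | hk
  · lift k to ℕ using hk
    have h1 : (-((k : ℤ) + 1)).toNat = 0 := by omega
    have h2 : (-(k : ℤ)).toNat = 0 := by omega
    have h3 : ((k : ℤ) + 1).toNat = k + 1 := by omega
    simp only [h1, h2, h3, Int.toNat_natCast, Finset.sum_range_succ]
    simp
    ring
  · obtain ⟨m, rfl⟩ : ∃ m : ℕ, k = -(m + 1 : ℤ) := ⟨(-k - 1).toNat, by omega⟩
    have h1 : (-(-((m : ℤ) + 1) + 1)).toNat = m := by omega
    have h2 : (-(-((m : ℤ) + 1))).toNat = m + 1 := by omega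
    have h3 : (-((m : ℤ) + 1) + 1).toNat = 0 := by omega
    have h4 : (-((m : ℤ) + 1)).toNat = 0 := by omega
    simp only [h1, h2, h3, h4, Finset.sum_range_succ]
    simp
    ring

lemma pot_sum {S : ℤ → ℤ} {a : ℤ → ℕ} (hS : IsPot S a) (i k : ℤ) (hik : i ≤ k) :
    S k = S i + ((∑ j ∈ Finset.Ioc i k, a j : ℕ) : ℤ) - (k - i) := by
  induction k, hik using Int.leInduction with
  | base => simp
  | succ k hk ih =>
    rw [hS k, ih]
    have : Finset.Ioc i (k + 1) = insert (k + 1) (Finset.Ioc i k) := by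
      ext x; simp only [Finset.mem_Ioc, Finset.mem_insert]; omega
    rw [this, Finset.sum_insert (by simp)]
    push_cast
    ring

lemma sum_cnt (h : Good n d R) (s : Finset ℤ) :
    ∑ j ∈ s, cnt n R j = (s.biUnion (pre n R)).card := by
  rw [Finset.card_biUnion]
  · rfl
  · intro x _ y _ hxy
    rw [Function.onFun, Finset.disjoint_left]
    intro i hi hi'
    rw [mem_pre h] at hi hi'
    exact hxy (hi.unique h hi')

lemma pot_lt (h : Good n d R) {S : ℤ → ℤ} (hS : IsPot S (cnt n R)) {i k : ℤ} (hik : i < k)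
    (hno : ∀ j, j ≤ k → ¬ Nx R i j) : S k < S i := by
  rw [pot_sum hS i k hik.le, sum_cnt h]
  have : (Finset.Ioc i k).biUnion (pre n R) ⊆ Finset.Ioo i k := by
    intro l hl
    simp only [Finset.mem_biUnion, Finset.mem_Ioc, mem_pre h, Finset.mem_Ioo] at hl ⊢
    obtain ⟨j, ⟨h1, h2⟩, h3⟩ := hl
    have h4 := h.lt h3.1
    refine ⟨?_, by omega⟩
    rcases lt_trichotomy i l with h5 | h5 | h5
    · exact h5
    · subst h5; exact absurd h3 (hno j h2)
    · obtain ⟨k', hk1, hk2⟩ := h3.nest h h5 h1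
      exact absurd hk2 (hno k' (by omega))
  have := Finset.card_le_card this
  rw [Int.card_Ioo] at this
  omega

lemma pot_ge (h : Good n d R) {S : ℤ → ℤ} (hS : IsPot S (cnt n R)) {i k : ℤ}
    (hN : Nx R i k) : S i ≤ S k := by
  have hik := h.lt hN.1
  rw [pot_sum hS i k hik.le, sum_cnt h]
  have : Finset.Ico i k ⊆ (Finset.Ioc i k).biUnion (pre n R) := by
    intro l hl
    simp only [Finset.mem_biUnion, Finset.mem_Ioc, mem_pre h, Finset.mem_Ico] at hl ⊢
    rcases eq_or_lt_of_le hl.1 with h1 | h1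
    · subst h1; exact ⟨k, ⟨hik, le_rfl⟩, hN⟩
    · obtain ⟨k', hk1, hk2⟩ := hN.nest h h1 hl.2
      have := h.lt hk2.1
      exact ⟨k', ⟨by omega, hk1⟩, hk2⟩
  have := Finset.card_le_card this
  rw [Int.card_Ico] at this
  omega

lemma rel_iff (h : Good n d R) {S : ℤ → ℤ} (hS : IsPot S (cnt n R)) (t : ℕ) :
    ∀ {i k : ℤ}, (k - i).toNat ≤ t → i < k → k ≤ i + n →
    (R i k ↔ ∀ l, i ≤ l → l ≤ k → S l ≤ S k) := by
  induction t with
  | zero => intro i k h1 h2; omega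
  | succ t ih =>
    intro i k ht hik hkn
    by_cases hex : ∃ j, j ≤ k ∧ Nx R i j
    · obtain ⟨j, hjk, hN⟩ := hex
      have hij := h.lt hN.1
      have hlt : ∀ l, i < l → l < j → S l < S i := fun l h1 h2 =>
        pot_lt h hS h1 (fun j' h3 h4 => by have := h4.unique h hN; omega)
      have hge := pot_ge h hS hN
      have hle : ∀ l, i ≤ l → l ≤ j → S l ≤ S j := by
        intro l h1 h2
        rcases eq_or_lt_of_le h1 with rfl | h1
        · exact hge
        rcases eq_or_lt_of_le h2 with rfl | h2
        · exact le_rfl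
        · exact (hlt l h1 h2).le.trans hge
      rcases eq_or_lt_of_le hjk with rfl | hjk
      · exact ⟨fun _ => hle, fun _ => hN.1⟩
      · rw [h.A hij hjk hkn hN.1, ih (by omega) hjk (by omega)]
        constructor
        · intro H l h1 h2
          rcases le_total l j with h3 | h3
          · exact (hle l h1 h3).trans (H j le_rfl hjk.le)
          · exact H l h3 h2
        · intro H l h1 h2
          exact H l (by omega) h2
    · push Not at hex
      constructor
      · intro hR
        obtain ⟨j, h1, h2⟩ := exists_nx h hR
        exact absurd h2 (hex j h1)
      · intro H
        have := pot_lt h hS hik hex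
        have := H i le_rfl hik.le
        omega

lemma sum_cnt_le (hd : 1 ≤ d) (h : Good n d R) : ∑ j ∈ Finset.Ioc (0 : ℤ) d, cnt n R j ≤ d := by
  have : NeZero d := ⟨by omega⟩
  rw [sum_cnt h]
  have := Finset.card_le_card_of_injOn (s := (Finset.Ioc (0 : ℤ) d).biUnion (pre n R))
    (t := (Finset.univ : Finset (ZMod d))) (fun x : ℤ => (x : ZMod d)) (by simp) ?_
  · simpa [ZMod.card] using this
  · intro x hx y hy hxy
    simp only [Finset.coe_biUnion, Set.mem_iUnion, Finset.mem_coe, Finset.mem_Ioc, mem_pre h,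
      exists_prop] at hx hy
    obtain ⟨j, hj, hxj⟩ := hx
    obtain ⟨j', hj', hyj⟩ := hy
    have h1 := (ZMod.intCast_eq_intCast_iff_dvd_sub x y d).1 hxy
    obtain ⟨c, hc⟩ := h1
    have h2 := (nx_per_mul h x j c).2 hxj
    have h3 : x + c * d = y := by linarith [mul_comm c (d : ℤ)]
    rw [h3] at h2
    have h4 := h2.unique h hyj
    have hc0 : c = 0 := by
      by_contra hne
      rcases lt_or_gt_of_ne hne with h5 | h5
      · nlinarith
      · nlinarith
    subst hc0
    simpa using h3

/-- relation from a potential -/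
def relS (n : ℕ) (S : ℤ → ℤ) (i k : ℤ) : Prop :=
  i < k ∧ k ≤ i + n ∧ ∀ l, i ≤ l → l ≤ k → S l ≤ S k

lemma good_relS {S : ℤ → ℤ} {c : ℤ} (hper : ∀ k, S (k + d) = S k - c) : Good n d (relS n S) where
  lt h := h.1
  le h := h.2.1
  per i k := by
    unfold relS
    refine and_congr (by omega) (and_congr (by omega) ⟨fun H l h1 h2 => ?_, fun H l h1 h2 => ?_⟩)
    · have := H (l + d) (by omega) (by omega)
      rw [hper, hper] at this
      omega
    · have := H (l - d) (by omega) (by omega)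
      have h3 := hper (l - d)
      rw [sub_add_cancel] at h3
      rw [hper]
      omega
  A {i j k} h1 h2 h3 h4 := by
    constructor
    · rintro ⟨_, _, H⟩
      exact ⟨h2, by omega, fun l h5 h6 => H l (by omega) h6⟩
    · rintro ⟨_, _, H⟩
      refine ⟨by omega, h3, fun l h5 h6 => ?_⟩
      rcases le_total l j with h7 | h7
      · exact (h4.2.2 l h5 h7).trans (H j le_rfl (by omega))
      · exact H l h7 h6
  B {i j k} h1 h2 h3 h4 := Or.inr ⟨h2, by omega, fun l h5 h6 => h4.2.2 l (by omega) h6⟩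

lemma nx_relS {S : ℤ → ℤ} {c : ℤ} (hc : 0 ≤ c) (hdn : d ≤ n) (hd : 1 ≤ d)
    (hper : ∀ k, S (k + d) = S k - c) (i j : ℤ) :
    Nx (relS n S) i j ↔ i < j ∧ S i ≤ S j ∧ ∀ l, i < l → l < j → S l < S i := by
  constructor
  · rintro ⟨⟨h1, h2, h3⟩, h4⟩
    refine ⟨h1, h3 i le_rfl h1.le, ?_⟩
    have key : ∀ t : ℕ, ∀ l, (l - i).toNat ≤ t → i < l → l < j → S l < S i := by
      intro t
      induction t with
      | zero => intro l _ _; omega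
      | succ t ih =>
        intro l hl h5 h6
        by_contra hcon
        refine h4 l h5 h6 ⟨h5, by omega, fun m h7 h8 => ?_⟩
        rcases eq_or_lt_of_le h7 with rfl | h7
        · omega
        rcases eq_or_lt_of_le h8 with rfl | h8
        · exact le_rfl
        have := ih m (by omega) h7 (by omega)
        omega
    exact fun l => key _ l le_rfl
  · rintro ⟨h1, h2, h3⟩
    have hj : j ≤ i + n := by
      by_contra hcon
      have h4 := h3 (j - d) (by omega) (by omega)
      have h5 := hper (j - d)
      rw [sub_add_cancel] at h5
      omega
    refine ⟨⟨h1, hj, ?_⟩, ?_⟩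
    · intro l h4 h5
      rcases eq_or_lt_of_le h4 with rfl | h4
      · exact h2
      rcases eq_or_lt_of_le h5 with rfl | h5
      · exact le_rfl
      exact (h3 l h4 h5).le.trans h2
    · intro l h4 h5 h6
      have := h6.2.2 i le_rfl h4.le
      have := h3 l h4 h5
      omega

lemma cnt_relS {S : ℤ → ℤ} {c : ℤ} {a : ℤ → ℕ} (hc : 0 ≤ c) (hdn : d ≤ n) (hd : 1 ≤ d)
    (hper : ∀ k, S (k + d) = S k - c) (hS : IsPot S a) (j : ℤ) :
    cnt n (relS n S) j = a j := by
  have hg : Good n d (relS n S) := good_relS hper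
  have hcard : (Finset.Ioc (S j - a j) (S j)).card = a j := by
    rw [Int.card_Ioc]; omega
  rw [← hcard]
  have hstep : S j = S (j - 1) + a j - 1 := by
    have := hS (j - 1)
    rwa [sub_add_cancel] at this
  unfold cnt
  refine Finset.card_bij (fun i _ => S i) ?_ ?_ ?_
  · intro i hi
    rw [mem_pre hg, nx_relS hc hdn hd hper] at hi
    obtain ⟨h1, h2, h3⟩ := hi
    rw [Finset.mem_Ioc]
    refine ⟨?_, h2⟩
    rcases eq_or_lt_of_le (show i ≤ j - 1 by omega) with h4 | h4
    · rw [h4]; omega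
    · have := h3 (j - 1) h4 (by omega)
      omega
  · intro x hx y hy hxy
    rw [mem_pre hg, nx_relS hc hdn hd hper] at hx hy
    rcases lt_trichotomy x y with h1 | h1 | h1
    · have := hx.2.2 y h1 hy.1; omega
    · exact h1
    · have := hy.2.2 x h1 hx.1; omega
  · intro v hv
    rw [Finset.mem_Ioc] at hv
    classical
    have hd' : S (j - d) = S j + c := by
      have := hper (j - d)
      rw [sub_add_cancel] at this
      omega
    have hex : ∃ t : ℕ, v ≤ S (j - 1 - t) := ⟨d - 1, by
      have : j - 1 - ((d - 1 : ℕ) : ℤ) = j - d := by omega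
      rw [this]; omega⟩
    have hs := Nat.find_spec hex
    have hm : ∀ l, j - 1 - Nat.find hex < l → l < j → S l < v := by
      intro l h1 h2
      have := Nat.find_min hex (m := (j - 1 - l).toNat) (by omega)
      rw [Int.toNat_of_nonneg (by omega)] at this
      rw [show j - 1 - (j - 1 - l) = l by ring] at this
      omega
    set i := j - 1 - (Nat.find hex : ℤ) with hi
    have hiv : S i = v := by
      rcases Nat.eq_zero_or_pos (Nat.find hex) with h0 | h0
      · have : i = j - 1 := by omega
        rw [this] at hs ⊢
        omega
      · have h1 := hm (i + 1) (by omega) (by omega)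
        rw [hS i] at h1
        omega
    refine ⟨i, ?_, hiv⟩
    rw [mem_pre hg, nx_relS hc hdn hd hper]
    refine ⟨by omega, by omega, fun l h1 h2 => ?_⟩
    rw [hiv]
    exact hm l h1 h2

end Part1

section Part2

def evl {n : ℕ} (σ : Edge n) (p : ℕ) : ℕ := if h : p < n + 1 then (σ.1 ⟨p, h⟩).val else 0

variable {n d : ℕ}

lemma evl_inj (σ : Edge n) {p q : ℕ} (hp : p ≤ n) (hq : q ≤ n) (h : evl σ p = evl σ q) :
    p = q := by
  unfold evl at h
  rw [dif_pos (by omega), dif_pos (by omega)] at h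
  have := σ.1.injective (Fin.ext h)
  simpa using this

lemma evl_avoid (σ : Edge n) {p q r : ℕ} (h1 : p < q) (h2 : q < r) (h3 : r ≤ n)
    (h4 : evl σ q < evl σ r) (h5 : evl σ r < evl σ p) : False := by
  unfold evl at h4 h5
  rw [dif_pos (by omega), dif_pos (by omega)] at h4 h5
  exact σ.2 ⟨⟨p, by omega⟩, ⟨q, by omega⟩, ⟨r, by omega⟩, h1, h2, h4, h5⟩

lemma headEqTail_iff (σ τ : Edge n) : HeadEqTail σ τ ↔
    ∀ p q : ℕ, p < n → q < n → (evl σ (p + 1) < evl σ (q + 1) ↔ evl τ p < evl τ q) := by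
  unfold HeadEqTail
  constructor
  · intro h p q hp hq
    have := h ⟨p, hp⟩ ⟨q, hq⟩
    unfold evl
    rw [dif_pos (by omega), dif_pos (by omega), dif_pos (by omega), dif_pos (by omega)]
    exact this
  · intro h a b
    have := h a b a.2 b.2
    unfold evl at this
    rw [dif_pos (by omega), dif_pos (by omega), dif_pos (by omega), dif_pos (by omega)] at this
    exact this

lemma edge_ext (σ τ : Edge n)
    (h : ∀ p q : ℕ, p < q → q ≤ n → (evl σ q < evl σ p ↔ evl τ q < evl τ p)) : σ = τ := by
  have h' : ∀ p q : Fin (n + 1), σ.1 p < σ.1 q ↔ τ.1 p < τ.1 q := by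
    intro p q
    have e : ∀ (ρ : Edge n) (p : Fin (n + 1)), evl ρ p = (ρ.1 p).val := by
      intro ρ p; unfold evl; rw [dif_pos p.2]
    rw [Fin.lt_def, Fin.lt_def, ← e, ← e, ← e, ← e]
    rcases lt_trichotomy p.val q.val with h1 | h1 | h1
    · have h2 := h p q h1 (by omega)
      have h3 := fun hh => evl_inj σ (p := p) (q := q) (by omega) (by omega) hh
      have h4 := fun hh => evl_inj τ (p := p) (q := q) (by omega) (by omega) hh
      omega
    · rw [h1]; simp
    · exact h q p h1 (by omega)
  apply Subtype.ext
  let f : Fin (n + 1) ≃o Fin (n + 1) :=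
    { toEquiv := σ.1.symm.trans τ.1
      map_rel_iff' := by
        intro a b
        have := h' (σ.1.symm b) (σ.1.symm a)
        simp only [Equiv.apply_symm_apply] at this
        simp only [Equiv.trans_apply]
        rw [← not_lt, ← not_lt, this] }
  have hf : f = OrderIso.refl _ := Subsingleton.elim _ _
  ext p
  have : f (σ.1 p) = σ.1 p := by rw [hf]; rfl
  have h2 : f (σ.1 p) = τ.1 p := by
    change τ.1 (σ.1.symm (σ.1 p)) = _
    simp
  rw [← this, h2]

lemma exists_edge (Q : ℕ → ℕ → Prop)
    (hA : ∀ {i j k}, i < j → j < k → k ≤ n → Q i j → (Q i k ↔ Q j k))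
    (hB : ∀ {i j k}, i < j → j < k → k ≤ n → Q i k → Q i j ∨ Q j k) :
    ∃ σ : Edge n, ∀ p q, p < q → q ≤ n → (evl σ q < evl σ p ↔ Q p q) := by
  classical
  let P : Fin (n + 1) → Fin (n + 1) → Prop := fun i j =>
    (i < j ∧ ¬ Q i j) ∨ (j < i ∧ Q j i)
  have hirr : ∀ i, ¬ P i i := by
    intro i h; simp [P] at h
  have htot : ∀ i j, i ≠ j → P i j ∨ P j i := by
    intro i j h
    simp only [P]
    rcases lt_or_gt_of_ne h with h1 | h1
    · by_cases h2 : Q i j <;> simp [h1, h2]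
    · by_cases h2 : Q j i <;> simp [h1, h2]
  have htr : ∀ i j k, P i j → P j k → P i k := by
    intro i j k h1 h2
    have a1 := @hA i j k
    have a2 := @hA i k j
    have a3 := @hA j i k
    have a4 := @hA j k i
    have a5 := @hA k i j
    have a6 := @hA k j i
    have b1 := @hB i j k
    have b2 := @hB i k j
    have b3 := @hB j i k
    have b4 := @hB j k i
    have b5 := @hB k i j
    have b6 := @hB k j i
    have i1 := i.2
    have i2 := j.2
    have i3 := k.2
    simp only [P, Fin.lt_def] at h1 h2 ⊢
    rcases lt_trichotomy i.val k.val with h3 | h3 | h3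
    · grind
    · have : i = k := Fin.ext h3
      subst this
      grind
    · grind
  let f : Fin (n + 1) → Fin (n + 1) := fun i =>
    ⟨(Finset.univ.filter (fun j => P j i)).card, by
      have : (Finset.univ.filter (fun j => P j i)) ⊂ Finset.univ := by
        rw [Finset.ssubset_univ_iff]
        intro h
        have : i ∈ (Finset.univ.filter (fun j => P j i)) := by rw [h]; simp
        simp [hirr] at this
      have := Finset.card_lt_card this
      simpa using this⟩
  have hmono : ∀ i j, P i j → f i < f j := by
    intro i j h
    rw [Fin.lt_def]
    change (Finset.univ.filter (fun k => P k i)).card < (Finset.univ.filter (fun k => P k j)).card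
    apply Finset.card_lt_card
    rw [Finset.ssubset_iff_of_subset]
    · exact ⟨i, by simpa using h, by simp [hirr]⟩
    · intro k hk
      simp only [Finset.mem_filter, Finset.mem_univ, true_and] at hk ⊢
      exact htr _ _ _ hk h
  have hiff : ∀ i j, f i < f j ↔ P i j := by
    intro i j
    refine ⟨fun h => ?_, hmono i j⟩
    by_contra hP
    have hne : i ≠ j := by rintro rfl; simp at h
    have := hmono j i ((htot i j hne).resolve_left hP)
    exact absurd this (not_lt.2 h.le)
  have hinj : Function.Injective f := by
    intro i j h
    by_contra hne
    rcases htot i j hne with h1 | h1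
    · exact absurd h (hmono _ _ h1).ne
    · exact absurd h (hmono _ _ h1).ne'
  let σ : Equiv.Perm (Fin (n + 1)) := Equiv.ofBijective f (Finite.injective_iff_bijective.1 hinj)
  have hσ : ∀ i, σ i = f i := fun i => rfl
  refine ⟨⟨σ, ?_⟩, ?_⟩
  · rintro ⟨i, j, k, h1, h2, h3, h4⟩
    rw [hσ, hσ, hiff] at h3 h4
    have a1 := @hA i j k h1 h2 (by omega)
    have b1 := @hB i j k h1 h2 (by omega)
    simp only [P, Fin.lt_def] at h1 h2 h3 h4
    grind
  · intro p q hpq hq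
    unfold evl
    rw [dif_pos (by omega), dif_pos (by omega)]
    change (f _).val < (f _).val ↔ _
    rw [← Fin.lt_def, hiff]
    simp only [P, Fin.lt_def]
    constructor
    · rintro (h | h)
      · omega
      · exact h.2
    · exact fun h => Or.inr ⟨hpq, h⟩

def IsWalk (W : ℤ → Edge n) : Prop := ∀ i, HeadEqTail (W i) (W (i + 1))

def relW (W : ℤ → Edge n) (i k : ℤ) : Prop :=
  i < k ∧ k ≤ i + n ∧ evl (W i) (k - i).toNat < evl (W i) 0

lemma walk_shift {W : ℤ → Edge n} (hW : IsWalk W) (s : ℕ) : ∀ (m : ℤ) (p q : ℕ),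
    p + s ≤ n → q + s ≤ n →
    (evl (W m) (p + s) < evl (W m) (q + s) ↔ evl (W (m + s)) p < evl (W (m + s)) q) := by
  induction s with
  | zero => intro m p q _ _; simp
  | succ s ih =>
    intro m p q hp hq
    have h1 := (headEqTail_iff _ _).1 (hW m) (p + s) (q + s) (by omega) (by omega)
    rw [← add_assoc, ← add_assoc, h1, ih (m + 1) p q (by omega) (by omega)]
    have : m + 1 + (s : ℤ) = m + ((s + 1 : ℕ) : ℤ) := by push_cast; ring
    rw [this]

lemma relW_iff {W : ℤ → Edge n} (hW : IsWalk W) (m : ℤ) (p q : ℕ) (hpq : p < q) (hq : q ≤ n) :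
    relW W (m + p) (m + q) ↔ evl (W m) q < evl (W m) p := by
  have := walk_shift hW p m (q - p) 0 (by omega) (by omega)
  rw [Nat.sub_add_cancel hpq.le, zero_add] at this
  rw [this]
  unfold relW
  have h1 : (m + (q : ℤ) - (m + p)).toNat = q - p := by omega
  rw [h1]
  constructor
  · exact fun h => h.2.2
  · exact fun h => ⟨by omega, by omega, h⟩

lemma good_relW {W : ℤ → Edge n} (hW : IsWalk W) (hper : ∀ i, W (i + d) = W i) :
    Good n d (relW W) where
  lt h := h.1
  le h := h.2.1
  per i k := by
    unfold relW
    rw [hper, show k + (d : ℤ) - (i + d) = k - i by ring]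
    refine and_congr (by omega) (and_congr (by omega) Iff.rfl)
  A {i j k} h1 h2 h3 := by
    obtain ⟨q, rfl⟩ : ∃ q : ℕ, j = i + q := ⟨(j - i).toNat, by omega⟩
    obtain ⟨r, rfl⟩ : ∃ r : ℕ, k = i + r := ⟨(k - i).toNat, by omega⟩
    have e1 := relW_iff hW i 0 q (by omega) (by omega)
    have e2 := relW_iff hW i 0 r (by omega) (by omega)
    have e3 := relW_iff hW i q r (by omega) (by omega)
    simp only [Nat.cast_zero, add_zero] at e1 e2
    rw [e1, e2, e3]
    have a1 := @evl_avoid n (W i) 0 q r (by omega) (by omega) (by omega)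
    have a2 := @evl_inj n (W i) q r (by omega) (by omega)
    intro h4
    constructor
    · intro h5
      by_contra h6
      have : evl (W i) q ≠ evl (W i) r := fun h => by have := a2 h; omega
      exact a1 (by omega) h5
    · intro h5; omega
  B {i j k} h1 h2 h3 := by
    obtain ⟨q, rfl⟩ : ∃ q : ℕ, j = i + q := ⟨(j - i).toNat, by omega⟩
    obtain ⟨r, rfl⟩ : ∃ r : ℕ, k = i + r := ⟨(k - i).toNat, by omega⟩
    have e1 := relW_iff hW i 0 q (by omega) (by omega)
    have e2 := relW_iff hW i 0 r (by omega) (by omega)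
    have e3 := relW_iff hW i q r (by omega) (by omega)
    simp only [Nat.cast_zero, add_zero] at e1 e2
    rw [e1, e2, e3]
    omega

lemma relW_inj {W W' : ℤ → Edge n} (hW : IsWalk W) (hW' : IsWalk W')
    (h : ∀ i k : ℤ, i < k → k ≤ i + n → (relW W i k ↔ relW W' i k)) : W = W' := by
  funext m
  apply edge_ext
  intro p q hpq hq
  rw [← relW_iff hW m p q hpq hq, ← relW_iff hW' m p q hpq hq]
  exact h _ _ (by omega) (by omega)

lemma exists_walk {R : ℤ → ℤ → Prop} (h : Good n d R) : ∃ W : ℤ → Edge n, IsWalk W ∧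
    (∀ i, W (i + d) = W i) ∧ relW W = R := by
  have hex : ∀ m : ℤ, ∃ σ : Edge n, ∀ p q : ℕ, p < q → q ≤ n →
      (evl σ q < evl σ p ↔ R (m + p) (m + q)) := by
    intro m
    apply exists_edge (n := n) (fun p q => R (m + p) (m + q))
    · intro i j k h1 h2 h3 h4
      exact h.A (by omega) (by omega) (by omega) h4
    · intro i j k h1 h2 h3 h4
      exact h.B (by omega) (by omega) (by omega) h4
  choose W hW using hex
  refine ⟨W, ?_, ?_, ?_⟩
  · intro m
    rw [headEqTail_iff]
    have key : ∀ p q : ℕ, p < q → q < n →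
        (evl (W m) (q + 1) < evl (W m) (p + 1) ↔ evl (W (m + 1)) q < evl (W (m + 1)) p) := by
      intro p q h1 h2
      rw [hW m (p + 1) (q + 1) (by omega) (by omega), hW (m + 1) p q h1 (by omega)]
      push_cast
      rw [show m + ((p : ℤ) + 1) = m + 1 + p by ring, show m + ((q : ℤ) + 1) = m + 1 + q by ring]
    intro p q hp hq
    rcases lt_trichotomy p q with h1 | h1 | h1
    · have h2 := key p q h1 hq
      have h3 := fun hh => evl_inj (W m) (p := p + 1) (q := q + 1) (by omega) (by omega) hh
      have h4 := fun hh => evl_inj (W (m + 1)) (p := p) (q := q) (by omega) (by omega) hh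
      omega
    · rw [h1]; simp
    · exact key q p h1 hp
  · intro m
    apply edge_ext
    intro p q h1 h2
    rw [hW _ p q h1 h2, hW _ p q h1 h2, ← h.per (m + p) (m + q)]
    rw [show m + (d : ℤ) + p = m + p + d by ring, show m + (d : ℤ) + q = m + q + d by ring]
  · funext i k
    apply propext
    unfold relW
    constructor
    · rintro ⟨h1, h2, h3⟩
      have := (hW i 0 (k - i).toNat (by omega) (by omega)).1 h3
      rw [Int.toNat_of_nonneg (by omega)] at this
      simpa using this
    · intro hR
      have h1 := h.lt hR
      have h2 := h.le hR
      refine ⟨h1, h2, (hW i 0 (k - i).toNat (by omega) (by omega)).2 ?_⟩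
      rw [Int.toNat_of_nonneg (by omega)]
      simpa using hR

end Part2

section Part3

variable {n d : ℕ}

lemma per_cast {α : Type*} (f : ℤ → α) (hf : ∀ i, f (i + d) = f i) (i : ℤ) :
    f (((i : ZMod d).cast : ℤ)) = f i := by
  rw [ZMod.coe_intCast]
  have hp : Function.Periodic f (d : ℤ) := hf
  have h1 := hp.int_mul (i / d) (i % d)
  rw [← h1]
  congr 1
  have := Int.emod_add_mul_ediv i d
  simp only [Int.cast_id]
  linarith [mul_comm (i / d) (d : ℤ)]

lemma sum_zmod [NeZero d] (a : ZMod d → ℕ) :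
    ∑ j ∈ Finset.Ioc (0 : ℤ) d, a (j : ZMod d) = ∑ x, a x := by
  have hinj : ∀ x ∈ Finset.Ioc (0 : ℤ) d, ∀ y ∈ Finset.Ioc (0 : ℤ) d,
      (x : ZMod d) = (y : ZMod d) → x = y := by
    intro x hx y hy hxy
    rw [Finset.mem_Ioc] at hx hy
    obtain ⟨c, hc⟩ := (ZMod.intCast_eq_intCast_iff_dvd_sub x y d).1 hxy
    have hc0 : c = 0 := by
      by_contra hne
      rcases lt_or_gt_of_ne hne with h5 | h5
      · nlinarith
      · nlinarith
    subst hc0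
    linarith
  classical
  have himg : (Finset.Ioc (0 : ℤ) d).image (fun j : ℤ => (j : ZMod d)) = Finset.univ := by
    rw [← Finset.card_eq_iff_eq_univ, Finset.card_image_of_injOn hinj]
    simp [ZMod.card]
  rw [← himg, Finset.sum_image hinj]

lemma card_seq [NeZero d] : Nat.card {a : ZMod d → ℕ // ∑ x, a x ≤ d} = (2 * d).choose d := by
  have e : {a : ZMod d → ℕ // ∑ x, a x ≤ d} ≃ {P : Option (ZMod d) → ℕ // ∑ i, P i = d} :=
    { toFun := fun a => ⟨fun o => o.elim (d - ∑ x, a.1 x) a.1, by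
        have := a.2
        rw [Fintype.sum_option]
        simp only [Option.elim]
        omega⟩
      invFun := fun P => ⟨fun x => P.1 (some x), by
        have := P.2
        rw [Fintype.sum_option] at this
        exact le_of_add_le_right this.le⟩
      left_inv := fun a => rfl
      right_inv := fun P => by
        apply Subtype.ext
        funext o
        have := P.2
        rw [Fintype.sum_option] at this
        cases o with
        | none => simp only [Option.elim]; omega
        | some x => rfl }
  classical
  rw [Nat.card_congr (e.trans (Sym.equivNatSumOfFintype (Option (ZMod d)) d).symm),
    Nat.card_eq_fintype_card, Sym.card_sym_eq_choose, Fintype.card_option, ZMod.card]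
  congr 1
  omega

def PW (n d : ℕ) : Type := {W : ℤ → Edge n // IsWalk W ∧ ∀ i, W (i + d) = W i}

noncomputable def PW.seq (hd : 1 ≤ d) (W : PW n d) : {a : ZMod d → ℕ // ∑' x, a x ≤ d} :=
  ⟨fun x => cnt n (relW W.1) x.cast, by
    have : NeZero d := ⟨by omega⟩
    have hg := good_relW W.2.1 W.2.2
    rw [tsum_fintype, ← sum_zmod]
    simp only [per_cast _ (cnt_per hg)]
    exact sum_cnt_le hd hg⟩

lemma PW.seq_apply (hd : 1 ≤ d) (W : PW n d) (j : ℤ) :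
    (W.seq hd).1 (j : ZMod d) = cnt n (relW W.1) j :=
  per_cast _ (cnt_per (good_relW W.2.1 W.2.2)) j

lemma PW.seq_bij (hd : 1 ≤ d) (hdn : d ≤ n) :
    Function.Bijective (PW.seq (n := n) hd) := by
  have : NeZero d := ⟨by omega⟩
  constructor
  · intro W W' h
    have hc : cnt n (relW W.1) = cnt n (relW W'.1) := by
      funext j
      rw [← PW.seq_apply hd, ← PW.seq_apply hd, h]
    obtain ⟨S, hS⟩ := exists_pot (cnt n (relW W.1))
    have hS' := hS
    rw [hc] at hS'
    apply Subtype.ext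
    apply relW_inj W.2.1 W'.2.1
    intro i k h1 h2
    rw [rel_iff (good_relW W.2.1 W.2.2) hS _ le_rfl h1 h2,
      rel_iff (good_relW W'.2.1 W'.2.2) hS' _ le_rfl h1 h2]
  · rintro ⟨a, ha⟩
    obtain ⟨S, hS⟩ := exists_pot (fun j : ℤ => a (j : ZMod d))
    rw [tsum_fintype, ← sum_zmod] at ha
    set s := ∑ j ∈ Finset.Ioc (0 : ℤ) d, a (j : ZMod d) with hs
    have hconst : ∀ k, S (k + d) - S k = S (0 + d) - S 0 := by
      intro k
      induction k using Int.induction_on with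
      | zero => rfl
      | succ k ih =>
        have h1 := hS k
        have h2 := hS (k + d)
        rw [show (k : ℤ) + 1 + d = k + d + 1 by ring, h1, h2, ← ih]
        push_cast
        simp
      | pred k ih =>
        have h1 := hS (-k - 1)
        have h2 := hS (-k - 1 + d)
        rw [show -(k : ℤ) - 1 + d + 1 = -k + d by ring] at h2
        rw [sub_add_cancel] at h1
        rw [h1, h2] at ih
        rw [← ih]
        push_cast
        simp
    have h0 := pot_sum hS 0 (0 + d) (by omega)
    rw [zero_add, ← hs] at h0
    have hper : ∀ k, S (k + d) = S k - ((d : ℤ) - s) := by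
      intro k
      have := hconst k
      rw [zero_add] at this
      omega
    obtain ⟨W, hW, hWp, hWr⟩ := exists_walk (good_relS (n := n) hper)
    refine ⟨⟨W, hW, hWp⟩, ?_⟩
    apply Subtype.ext
    funext x
    have hx : ((x.cast : ℤ) : ZMod d) = x := ZMod.intCast_zmod_cast x
    rw [← hx]
    refine (PW.seq_apply hd _ _).trans ?_
    change cnt n (relW W) _ = a _
    rw [hWr]
    exact cnt_relS (by omega) hdn hd hper hS _

lemma card_PW (hd : 1 ≤ d) (hdn : d ≤ n) : Nat.card (PW n d) = (2 * d).choose d := by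
  have : NeZero d := ⟨by omega⟩
  rw [Nat.card_eq_of_bijective _ (PW.seq_bij hd hdn), ← card_seq]
  simp only [tsum_fintype]

end Part3

section Part4

open Function

variable {n d : ℕ}

def BW (n : ℕ) : Type := {W : ℤ → Edge n // IsWalk W}

def BW.T (x : BW n) : BW n := ⟨fun i => x.1 (i + 1), fun i => x.2 (i + 1)⟩

lemma BW.iter (k : ℕ) (x : BW n) (i : ℤ) : (BW.T^[k] x).1 i = x.1 (i + k) := by
  induction k generalizing i with
  | zero => simp
  | succ k ih =>
    rw [Function.iterate_succ_apply']
    change (BW.T^[k] x).1 (i + 1) = _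
    rw [ih]
    push_cast
    ring_nf

lemma BW.periodic_iff (x : BW n) : IsPeriodicPt BW.T d x ↔ ∀ i, x.1 (i + d) = x.1 i := by
  constructor
  · intro h i
    rw [← BW.iter, h.eq]
  · intro h
    apply Subtype.ext
    funext i
    rw [BW.iter, h]

lemma card_periodic (hd : 1 ≤ d) (hdn : d ≤ n) :
    Nat.card {x : BW n // IsPeriodicPt BW.T d x} = (2 * d).choose d := by
  rw [← card_PW hd hdn]
  refine Nat.card_congr
    { toFun := fun x => ⟨x.1.1, x.1.2, (BW.periodic_iff _).1 x.2⟩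
      invFun := fun W => ⟨⟨W.1, W.2.1⟩, (BW.periodic_iff _).2 W.2.2⟩
      left_inv := fun x => rfl
      right_inv := fun x => rfl }

def toBW (w : ClosedWalk n d) : BW n :=
  ⟨fun i => w.1 (i : ZMod d), fun i => by
    have := w.2 (i : ZMod d)
    simpa using this⟩

lemma toBW_per (w : ClosedWalk n d) : IsPeriodicPt BW.T d (toBW w) := by
  rw [BW.periodic_iff]
  intro i
  simp [toBW]

lemma toBW_inj : Injective (toBW : ClosedWalk n d → BW n) := by
  intro w w' h
  apply Subtype.ext
  funext x
  have := congrFun (congrArg Subtype.val h) (x.cast : ℤ)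
  simpa [toBW] using this

lemma toBW_surj (x : BW n) (hx : IsPeriodicPt BW.T d x) : ∃ w : ClosedWalk n d, toBW w = x := by
  have hp := (BW.periodic_iff x).1 hx
  refine ⟨⟨fun i => x.1 (i.cast : ℤ), fun i => ?_⟩, ?_⟩
  · have h1 : x.1 ((i + 1 : ZMod d).cast : ℤ) = x.1 ((i.cast : ℤ) + 1) := by
      rw [← per_cast x.1 hp ((i.cast : ℤ) + 1)]
      simp
    change HeadEqTail (x.1 (i.cast : ℤ)) (x.1 ((i + 1 : ZMod d).cast : ℤ))
    rw [h1]
    exact x.2 _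
  · apply Subtype.ext
    funext i
    exact per_cast x.1 hp i

def sh (w : ClosedWalk n d) (c : ZMod d) : ClosedWalk n d :=
  ⟨fun i => w.1 (i + c), fun i => by
    have := w.2 (i + c)
    rwa [show i + c + 1 = i + 1 + c by ring] at this⟩

lemma walkClass_eq (w : ClosedWalk n d) : walkClass w = Set.range (sh w) := by
  ext w'
  constructor
  · rintro ⟨c, hc⟩
    exact ⟨c, Subtype.ext (funext fun i => (hc i).symm)⟩
  · rintro ⟨c, rfl⟩
    exact ⟨c, fun i => rfl⟩

lemma sh_sh (w : ClosedWalk n d) (c c' : ZMod d) : sh (sh w c) c' = sh w (c + c') := by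
  apply Subtype.ext
  funext i
  change w.1 (i + c' + c) = w.1 (i + (c + c'))
  ring_nf

lemma sh_zero (w : ClosedWalk n d) : sh w 0 = w := by
  apply Subtype.ext
  funext i
  change w.1 (i + 0) = w.1 i
  rw [add_zero]

lemma toBW_sh (w : ClosedWalk n d) (k : ℕ) : toBW (sh w k) = BW.T^[k] (toBW w) := by
  apply Subtype.ext
  funext i
  rw [BW.iter]
  simp [toBW, sh]

lemma sh_eq_iff (w : ClosedWalk n d) (k : ℕ) : sh w k = w ↔ IsPeriodicPt BW.T k (toBW w) := by
  rw [← toBW_inj.eq_iff, toBW_sh]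
  rfl

lemma mem_class_self (w : ClosedWalk n d) : w ∈ walkClass w := by
  rw [walkClass_eq]
  exact ⟨0, sh_zero w⟩

lemma class_eq_of_mem {w w' : ClosedWalk n d} (h : w' ∈ walkClass w) :
    walkClass w' = walkClass w := by
  rw [walkClass_eq] at h
  obtain ⟨c, rfl⟩ := h
  rw [walkClass_eq, walkClass_eq]
  ext v
  constructor
  · rintro ⟨c', rfl⟩
    exact ⟨_, (sh_sh w c c').symm⟩
  · rintro ⟨c', rfl⟩
    exact ⟨c' - c, by rw [sh_sh]; congr 1; ring⟩

lemma ncard_class_iff [NeZero d] (w : ClosedWalk n d) :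
    (walkClass w).ncard = d ↔ minimalPeriod BW.T (toBW w) = d := by
  have hpos : 0 < d := Nat.pos_of_ne_zero (NeZero.ne d)
  rw [walkClass_eq]
  have h1 : (Set.range (sh w)).ncard = d ↔ Injective (sh w) := by
    rw [← Set.image_univ]
    have h2 := Set.ncard_image_iff (f := sh w) (s := Set.univ) Set.finite_univ
    rw [Set.ncard_univ, Nat.card_zmod, Set.injOn_univ] at h2
    exact h2
  rw [h1]
  have hdvd := (toBW_per w).minimalPeriod_dvd
  constructor
  · intro hinj
    have h2 := (sh_eq_iff w _).2 (isPeriodicPt_minimalPeriod BW.T (toBW w))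
    have h3 : ((minimalPeriod BW.T (toBW w) : ℕ) : ZMod d) = 0 := hinj (h2.trans (sh_zero w).symm)
    exact Nat.dvd_antisymm hdvd ((ZMod.natCast_eq_zero_iff _ _).1 h3)
  · intro hmin c c' hcc
    have h2 : sh w (c - c') = w := by
      have := congrArg (fun v => sh v (-c')) hcc
      simp only [sh_sh, add_neg_cancel, sh_zero] at this
      rw [sub_eq_add_neg, this]
    rw [← ZMod.natCast_zmod_val (c - c'), sh_eq_iff] at h2
    have h3 := h2.minimalPeriod_dvd
    rw [hmin, ← ZMod.natCast_eq_zero_iff, ZMod.natCast_zmod_val] at h3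
    exact sub_eq_zero.1 h3

instance : Finite (Edge n) := by unfold Edge; infer_instance

instance [NeZero d] : Finite (ClosedWalk n d) := by unfold ClosedWalk; infer_instance

lemma card_min [NeZero d] :
    Nat.card {x : BW n // minimalPeriod BW.T x = d}
      = d * Nat.card {S : Set (ClosedWalk n d) // IsCycleClass S} := by
  have h1 : Nat.card {x : BW n // minimalPeriod BW.T x = d}
      = Nat.card {w : ClosedWalk n d // (walkClass w).ncard = d} := by
    symm
    refine Nat.card_eq_of_bijective
      (fun w => ⟨toBW w.1, (ncard_class_iff w.1).1 w.2⟩) ⟨?_, ?_⟩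
    · intro w w' h
      exact Subtype.ext (toBW_inj (congrArg Subtype.val h))
    · rintro ⟨x, hx⟩
      obtain ⟨w, hw⟩ := toBW_surj (d := d) x (by
        have := isPeriodicPt_minimalPeriod BW.T x
        rwa [hx] at this)
      subst hw
      exact ⟨⟨w, (ncard_class_iff w).2 hx⟩, rfl⟩
  let e : {w : ClosedWalk n d // (walkClass w).ncard = d} ≃
      (Σ S : {S : Set (ClosedWalk n d) // IsCycleClass S}, S.1) :=
    { toFun := fun w => ⟨⟨walkClass w.1, ⟨w.1, rfl⟩, w.2⟩, ⟨w.1, mem_class_self w.1⟩⟩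
      invFun := fun p => ⟨p.2.1, by
        obtain ⟨⟨S, ⟨w, rfl⟩, hS⟩, ⟨v, hv⟩⟩ := p
        change (walkClass v).ncard = d
        rw [class_eq_of_mem hv]
        exact hS⟩
      left_inv := fun w => rfl
      right_inv := by
        rintro ⟨⟨S, ⟨w, rfl⟩, hS⟩, ⟨v, hv⟩⟩
        have := class_eq_of_mem hv
        refine Sigma.subtype_ext (Subtype.ext this) rfl }
  rw [h1, Nat.card_congr e]
  have := Fintype.ofFinite {S : Set (ClosedWalk n d) // IsCycleClass S}
  rw [Nat.card_sigma, Finset.sum_congr rfl (g := fun _ => d)]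
  · simp [mul_comm]
  · intro S _
    rw [Nat.card_coe_set_eq]
    exact S.2.2

lemma sum_min (hd : 1 ≤ d) (hdn : d ≤ n) :
    ∑ e ∈ d.divisors, Nat.card {x : BW n // minimalPeriod BW.T x = e} = (2 * d).choose d := by
  rw [← card_periodic hd hdn]
  have hfin : ∀ e ∈ d.divisors, Finite {x : BW n // minimalPeriod BW.T x = e} := by
    intro e he
    have hepos := Nat.pos_of_mem_divisors he
    have hen : e ≤ n := (Nat.divisor_le he).trans hdn
    have : Finite {x : BW n // IsPeriodicPt BW.T e x} := by
      apply Nat.finite_of_card_ne_zero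
      rw [card_periodic hepos hen]
      exact (Nat.choose_pos (by omega)).ne'
    refine Finite.of_injective (β := {x : BW n // IsPeriodicPt BW.T e x})
      (fun x => ⟨x.1, by
        have := isPeriodicPt_minimalPeriod BW.T x.1
        rwa [x.2] at this⟩) ?_
    intro x y h
    exact Subtype.ext (congrArg (fun z => z.1) h)
  have h2 : ∀ e : d.divisors, Finite {x : BW n // minimalPeriod BW.T x = (e : ℕ)} :=
    fun e => hfin e.1 e.2
  rw [← Finset.sum_coe_sort, ← Nat.card_sigma]
  refine Nat.card_congr
    { toFun := fun p => ⟨p.2.1, by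
        rw [isPeriodicPt_iff_minimalPeriod_dvd, p.2.2]
        exact Nat.dvd_of_mem_divisors p.1.2⟩
      invFun := fun x => ⟨⟨minimalPeriod BW.T x.1, by
        rw [Nat.mem_divisors]
        exact ⟨x.2.minimalPeriod_dvd, by omega⟩⟩, ⟨x.1, rfl⟩⟩
      left_inv := by
        rintro ⟨⟨e, he⟩, ⟨x, hx⟩⟩
        exact Sigma.subtype_ext (Subtype.ext hx) rfl
      right_inv := fun x => rfl }

end Part4


/-- For `1 ≤ d ≤ n`, the number of `d`-cycles in `G(n, 312)` is
`(1/d) · Σ_{e ∣ d} μ(d/e) · binomial (2e) e`. -/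
theorem card_d_cycles (n d : ℕ) (hd : 1 ≤ d) (hdn : d ≤ n) :
    (Nat.card {S : Set (ClosedWalk n d) // IsCycleClass S} : ℚ)
      = (1 / (d : ℚ)) * ∑ e ∈ d.divisors,
          ((ArithmeticFunction.moebius (d / e) : ℤ) : ℚ) * ((2 * e).choose e : ℚ) := by
  have : NeZero d := ⟨by omega⟩
  have key := (ArithmeticFunction.sum_eq_iff_sum_mul_moebius_eq_on (R := ℚ)
    (f := fun e => (Nat.card {x : BW n // Function.minimalPeriod BW.T x = e} : ℚ))
    (g := fun e => ((2 * e).choose e : ℚ)) {m | 1 ≤ m ∧ m ≤ n} (by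
      rintro a b hab ⟨h1, h2⟩
      exact ⟨Nat.pos_of_dvd_of_pos hab h1, (Nat.le_of_dvd h1 hab).trans h2⟩)).1 (by
      rintro m _ ⟨h1, h2⟩
      rw [← sum_min h1 h2]
      push_cast
      rfl) d (by omega) ⟨hd, hdn⟩
  rw [card_min] at key
  rw [Nat.sum_divisorsAntidiagonal' (fun a b =>
    ((ArithmeticFunction.moebius a : ℤ) : ℚ) * ((2 * b).choose b : ℚ))] at key
  rw [key]
  have : (d : ℚ) ≠ 0 := by exact_mod_cast NeZero.ne d
  push_cast
  field_simp
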